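/- (Lemma 2, Bernstein-type deviation bound.) Let (U_i,V_i)_{i=1,…,n₂} be i.i.d. [0,1]²-valued with bounded density c, let c_{j,k} = ∫ φ_{j,k} c, let (d_k) be real numbers (indexed by the finitely many relevant k), set T = Σ_k (c_{j,k} − d_k)² and assume T > 0. Define T^♦ = n₂^{−1} Σ_{i=1}^{n₂} Σ_k (φ_{j,k}(U_i,V_i) − c_{j,k}) (c_{j,k} − d_k). Then there exists a constant K > 0, depending only on L, ‖φ‖_∞ and ‖c‖_∞, such that for all x > 0, P(|T^♦| ≥ x) ≤ 2 exp( − K n₂ x² / ( T + x 2^{j} T^{1/2} ) ). -/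

import Mathlib

open MeasureTheory

noncomputable section

/-- The unit square `[0,1]² ⊆ ℝ²`. -/
def unitSq : Set (ℝ × ℝ) := Set.Icc (0 : ℝ) 1 ×ˢ Set.Icc (0 : ℝ) 1

/-- The tensor-product scaling family `φ_{j,k}(u,v) = 2^j φ(2^j u − k₁) φ(2^j v − k₂)`. -/
def phiJK (φ : ℝ → ℝ) (j : ℕ) (k : ℤ × ℤ) (z : ℝ × ℝ) : ℝ :=
  2 ^ j * φ (2 ^ j * z.1 - k.1) * φ (2 ^ j * z.2 - k.2)

section Bernstein

variable {Ω : Type*} [MeasurableSpace Ω] {ν : Measure Ω} [IsProbabilityMeasure ν]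
  {h : Ω → ℝ} {B v : ℝ}

lemma integral_exp_mul_le_of_bounded (hm : Measurable h) (hB : ∀ z, |h z| ≤ B)
    (h0 : ∫ z, h z ∂ν = 0) (hv : ∫ z, h z ^ 2 ∂ν ≤ v) {s : ℝ} (hs : 0 ≤ s) (hsB : s * B ≤ 1) :
    ∫ z, Real.exp (s * h z) ∂ν ≤ Real.exp (s ^ 2 * v) := by
  have hs1 (z : Ω) : |s * h z| ≤ 1 := by
    rw [abs_mul, abs_of_nonneg hs]
    exact (mul_le_mul_of_nonneg_left (hB z) hs).trans hsB
  have hi : Integrable h ν := .of_bound hm.aestronglyMeasurable B (.of_forall hB)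
  have hi2 : Integrable (fun z => h z ^ 2) ν :=
    .of_bound (by fun_prop) (B ^ 2) (.of_forall fun z => by
      rw [Real.norm_eq_abs, abs_pow]
      exact pow_le_pow_left₀ (abs_nonneg _) (hB z) 2)
  have hie : Integrable (fun z => Real.exp (s * h z)) ν :=
    .of_bound (by fun_prop) (Real.exp 1) (.of_forall fun z => by
      rw [Real.norm_eq_abs, Real.abs_exp]
      exact Real.exp_le_exp.mpr (abs_le.mp (hs1 z)).2)
  have hlin : Integrable (fun z => 1 + s * h z) ν := (integrable_const 1).add (hi.const_mul s)
  calc ∫ z, Real.exp (s * h z) ∂ν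
      ≤ ∫ z, (1 + s * h z + s ^ 2 * h z ^ 2) ∂ν := by
        refine integral_mono hie (hlin.add (hi2.const_mul (s ^ 2))) fun z => ?_
        have := (abs_le.mp (Real.abs_exp_sub_one_sub_id_le (hs1 z))).2
        dsimp only
        linarith [mul_pow s (h z) 2]
    _ = 1 + s ^ 2 * ∫ z, h z ^ 2 ∂ν := by
        rw [integral_add hlin (hi2.const_mul (s ^ 2)),
          integral_add (integrable_const 1) (hi.const_mul s), integral_const_mul,
          integral_const_mul, h0]
        simp
    _ ≤ 1 + s ^ 2 * v := by gcongr
    _ ≤ Real.exp (s ^ 2 * v) := by linarith [Real.add_one_le_exp (s ^ 2 * v)]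

/-- One-sided Bernstein inequality for sums of bounded i.i.d. centered random variables. -/
lemma measureReal_pi_le_sum_le_exp (hm : Measurable h) (hB : ∀ z, |h z| ≤ B)
    (h0 : ∫ z, h z ∂ν = 0) (hv : ∫ z, h z ^ 2 ∂ν ≤ v) (hvpos : 0 < v) (n : ℕ) {x : ℝ}
    (hx : 0 < x) (hBnonneg : 0 ≤ B) :
    (Measure.pi fun _ : Fin n => ν).real {ω | n * x ≤ ∑ i, h (ω i)} ≤
      Real.exp (-(n * x ^ 2 / (4 * v + 2 * B * x))) := by
  have hD : 0 < 2 * v + B * x := by positivity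
  set s := x / (2 * v + B * x) with hs_def
  have hs : 0 ≤ s := by positivity
  have hsD : s * (2 * v + B * x) = x := div_mul_cancel₀ _ hD.ne'
  have hsB : s * B ≤ 1 := by
    rw [hs_def, div_mul_eq_mul_div, div_le_one hD]
    linarith
  have hint : Integrable (fun ω : Fin n → Ω => Real.exp (s * ∑ i, h (ω i)))
      (Measure.pi fun _ : Fin n => ν) :=
    .of_bound (Measurable.aestronglyMeasurable (by fun_prop)) (Real.exp (s * ∑ _i : Fin n, B)) (.of_forall fun ω => by
      rw [Real.norm_eq_abs, Real.abs_exp]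
      gcongr with i
      exact (abs_le.mp (hB _)).2)
  have hmgf : ProbabilityTheory.mgf (fun ω : Fin n → Ω => ∑ i, h (ω i))
      (Measure.pi fun _ : Fin n => ν) s ≤ Real.exp (s ^ 2 * v) ^ n := by
    simp only [ProbabilityTheory.mgf, Finset.mul_sum, Real.exp_sum]
    rw [integral_fintype_prod_eq_pow (fun z => Real.exp (s * h z)), Fintype.card_fin]
    exact pow_le_pow_left₀ (integral_nonneg fun _ => (Real.exp_pos _).le)
      (integral_exp_mul_le_of_bounded hm hB h0 hv hs hsB) n
  calc _ ≤ Real.exp (-s * (n * x)) * Real.exp (s ^ 2 * v) ^ n :=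
        (ProbabilityTheory.measure_ge_le_exp_mul_mgf _ hs hint).trans (by gcongr)
    _ = Real.exp (-(n * (s * (x - s * v)))) := by
        rw [← Real.exp_nat_mul, ← Real.exp_add]
        ring_nf
    _ ≤ _ := by
        have hsv : s * v ≤ x / 2 := by
          have : 0 ≤ s * (B * x) := by positivity
          linarith
        have hhalf : x ^ 2 / (4 * v + 2 * B * x) = s * (x / 2) := by
          rw [hs_def]
          field_simp
          ring
        rw [mul_div_assoc, hhalf]
        gcongr
        linarith

/-- Two-sided Bernstein inequality for sums of bounded i.i.d. centered random variables. -/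
lemma measureReal_pi_le_abs_sum_le_exp (hm : Measurable h) (hB : ∀ z, |h z| ≤ B)
    (h0 : ∫ z, h z ∂ν = 0) (hv : ∫ z, h z ^ 2 ∂ν ≤ v) (hvpos : 0 < v) (n : ℕ) {x : ℝ}
    (hx : 0 < x) (hBnonneg : 0 ≤ B) :
    (Measure.pi fun _ : Fin n => ν).real {ω | n * x ≤ |∑ i, h (ω i)|} ≤
      2 * Real.exp (-(n * x ^ 2 / (4 * v + 2 * B * x))) := by
  have hup := measureReal_pi_le_sum_le_exp hm hB h0 hv hvpos n hx hBnonneg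
  have hlow := measureReal_pi_le_sum_le_exp (ν := ν) (h := fun z => -h z) (B := B) (v := v)
    hm.neg (by simpa using hB) (by rw [integral_neg, h0, neg_zero]) (by simpa using hv) hvpos n hx
    hBnonneg
  have hsub : {ω : Fin n → Ω | n * x ≤ |∑ i, h (ω i)|} ⊆
      {ω | n * x ≤ ∑ i, h (ω i)} ∪ {ω | n * x ≤ ∑ i, -h (ω i)} := by
    intro ω hω
    simpa [Finset.sum_neg_distrib] using le_abs.mp hω
  have hunion := (measureReal_mono (μ := Measure.pi fun _ : Fin n => ν) hsub).trans
    (measureReal_union_le _ _)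
  linarith

end Bernstein

lemma isFiniteMeasure_restrict_unitSq : IsFiniteMeasure (volume.restrict unitSq) :=
  isFiniteMeasure_restrict.mpr
    (isCompact_Icc.prod isCompact_Icc : IsCompact unitSq).measure_lt_top.ne

lemma integral_withDensity_eq_setIntegral {c : ℝ × ℝ → ℝ} (hc : Measurable c)
    (hc0 : ∀ z, 0 ≤ c z) (hcs : ∀ z ∉ unitSq, c z = 0) (f : ℝ × ℝ → ℝ) :
    ∫ z, f z ∂(volume.withDensity fun z => ENNReal.ofReal (c z)) = ∫ z in unitSq, f z * c z := by
  rw [integral_withDensity_eq_integral_toReal_smul (by fun_prop) (by simp),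
    setIntegral_eq_integral_of_forall_compl_eq_zero fun z hz => by rw [hcs z hz, mul_zero]]
  simp [ENNReal.toReal_ofReal, hc0, mul_comm]

lemma measurable_phiJK {φ : ℝ → ℝ} (hφ : Measurable φ) (j : ℕ) (k : ℤ × ℤ) :
    Measurable (phiJK φ j k) := by
  unfold phiJK
  fun_prop

lemma abs_phiJK_le {φ : ℝ → ℝ} {Cφ : ℝ} (hφ : ∀ t, |φ t| ≤ Cφ) (j : ℕ) (k : ℤ × ℤ) (z : ℝ × ℝ) :
    |phiJK φ j k z| ≤ 2 ^ j * Cφ ^ 2 := by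
  have hC : 0 ≤ Cφ := (abs_nonneg _).trans (hφ 0)
  rw [phiJK, abs_mul, abs_mul, abs_of_pos (by positivity : (0 : ℝ) < 2 ^ j), mul_assoc, sq]
  gcongr <;> exact hφ _

lemma sum_abs_phiJK_le {φ : ℝ → ℝ} {Cφ L : ℝ} (hL : 0 ≤ L) (hφ : ∀ t, |φ t| ≤ Cφ)
    (hsupp : ∀ t ∉ Set.Icc (0 : ℝ) L, φ t = 0) (j : ℕ) (s : Finset (ℤ × ℤ)) (z : ℝ × ℝ) :
    ∑ k ∈ s, |phiJK φ j k z| ≤ (L + 1) ^ 2 * (2 ^ j * Cφ ^ 2) := by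
  let I (y : ℝ) : Finset ℤ := Finset.Icc ⌈y - L⌉ ⌊y⌋
  have hI (y : ℝ) (m : ℤ) (hm : φ (y - m) ≠ 0) : m ∈ I y := by
    have := not_imp_comm.mp (hsupp (y - m)) hm
    rw [Finset.mem_Icc, Int.ceil_le, Int.le_floor]
    constructor <;> linarith [this.1, this.2]
  have hcard (y : ℝ) : ((I y).card : ℝ) ≤ L + 1 := by
    have hle : ((⌊y⌋ + 1 - ⌈y - L⌉ : ℤ) : ℝ) ≤ L + 1 := by
      push_cast
      linarith [Int.floor_le y, Int.le_ceil (y - L)]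
    rw [Int.card_Icc, ← Int.cast_natCast, Int.toNat_eq_max, Int.cast_max]
    exact max_le hle (by push_cast; linarith)
  set S := I (2 ^ j * z.1) ×ˢ I (2 ^ j * z.2)
  have hzero (k : ℤ × ℤ) (hk : k ∉ S) : |phiJK φ j k z| = 0 := by
    rw [abs_eq_zero]
    by_contra hne
    simp only [phiJK, mul_eq_zero, not_or] at hne
    exact hk (Finset.mem_product.mpr ⟨hI _ _ hne.1.2, hI _ _ hne.2⟩)
  calc ∑ k ∈ s, |phiJK φ j k z|
      ≤ ∑ k ∈ s ∪ S, |phiJK φ j k z| :=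
        Finset.sum_le_sum_of_subset_of_nonneg Finset.subset_union_left fun _ _ _ => abs_nonneg _
    _ = ∑ k ∈ S, |phiJK φ j k z| :=
        (Finset.sum_subset Finset.subset_union_right fun k _ hk => hzero k hk).symm
    _ ≤ S.card • (2 ^ j * Cφ ^ 2) :=
        Finset.sum_le_card_nsmul _ _ _ fun k _ => abs_phiJK_le hφ j k z
    _ ≤ (L + 1) ^ 2 * (2 ^ j * Cφ ^ 2) := by
        rw [nsmul_eq_mul, Finset.card_product, Nat.cast_mul, sq (L + 1)]
        gcongr <;> exact hcard _

lemma abs_sum_phiJK_mul_le {φ : ℝ → ℝ} {Cφ L : ℝ} (hL : 0 ≤ L) (hφ : ∀ t, |φ t| ≤ Cφ)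
    (hsupp : ∀ t ∉ Set.Icc (0 : ℝ) L, φ t = 0) (j : ℕ) (s : Finset (ℤ × ℤ)) (a : ℤ × ℤ → ℝ)
    (z : ℝ × ℝ) :
    |∑ k ∈ s, phiJK φ j k z * a k| ≤
      (L + 1) ^ 2 * (2 ^ j * Cφ ^ 2) * √(∑ k ∈ s, a k ^ 2) := by
  calc |∑ k ∈ s, phiJK φ j k z * a k|
      ≤ ∑ k ∈ s, |phiJK φ j k z| * √(∑ k ∈ s, a k ^ 2) := by
        refine (Finset.abs_sum_le_sum_abs _ _).trans (Finset.sum_le_sum fun k hk => ?_)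
        rw [abs_mul]
        gcongr
        exact Real.abs_le_sqrt (Finset.single_le_sum (fun _ _ => sq_nonneg _) hk)
    _ ≤ _ := by
        rw [← Finset.sum_mul]
        gcongr
        exact sum_abs_phiJK_le hL hφ hsupp j s z

lemma setIntegral_sq_sum_phiJK_mul {φ : ℝ → ℝ} {Cφ : ℝ} (hm : Measurable φ)
    (hφ : ∀ t, |φ t| ≤ Cφ) (j : ℕ) (s : Finset (ℤ × ℤ)) (a : ℤ × ℤ → ℝ)
    (horth : ∀ k ∈ s, ∀ k' ∈ s,
      (∫ z in unitSq, phiJK φ j k z * phiJK φ j k' z) = if k = k' then 1 else 0) :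
    ∫ z in unitSq, (∑ k ∈ s, phiJK φ j k z * a k) ^ 2 = ∑ k ∈ s, a k ^ 2 := by
  have := isFiniteMeasure_restrict_unitSq
  have hi (k k' : ℤ × ℤ) :
      Integrable (fun z => a k * a k' * (phiJK φ j k z * phiJK φ j k' z))
        (volume.restrict unitSq) := by
    have hk := measurable_phiJK hm j k
    have hk' := measurable_phiJK hm j k'
    refine (Integrable.of_bound (by fun_prop) ((2 ^ j * Cφ ^ 2) * (2 ^ j * Cφ ^ 2))
      (.of_forall fun z => ?_)).const_mul _
    rw [norm_mul]
    exact mul_le_mul (abs_phiJK_le hφ j k z) (abs_phiJK_le hφ j k' z) (norm_nonneg _)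
      (by positivity)
  have hexp (z : ℝ × ℝ) : (∑ k ∈ s, phiJK φ j k z * a k) ^ 2 =
      ∑ k ∈ s, ∑ k' ∈ s, a k * a k' * (phiJK φ j k z * phiJK φ j k' z) := by
    rw [sq, Finset.sum_mul_sum]
    refine Finset.sum_congr rfl fun k _ => Finset.sum_congr rfl fun k' _ => by ring
  simp_rw [hexp]
  rw [integral_finsetSum _ fun k _ => integrable_finsetSum _ fun k' _ => hi k k']
  refine Finset.sum_congr rfl fun k hk => ?_
  rw [integral_finsetSum _ fun k' _ => hi k k']
  simp_rw [integral_const_mul]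
  rw [Finset.sum_congr rfl fun k' hk' => by rw [horth k hk k' hk']]
  simp [hk, sq]

/-- **Lemma 2, Bernstein-type deviation bound.**
For i.i.d. `(U_i,V_i)` with bounded density `c` on `[0,1]²`, the centered linear
statistic `T♦ = n₂⁻¹ Σ_i Σ_k (φ_{j,k}(U_i,V_i) − c_{j,k})(c_{j,k} − d_k)` satisfies
`P(|T♦| ≥ x) ≤ 2 exp(−K n₂ x²/(T + x 2^j T^{1/2}))`, with `K` depending only on `L`,
`‖φ‖_∞` and `‖c‖_∞`, where `T = Σ_k (c_{j,k} − d_k)² > 0`. -/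
theorem lemma2_bernstein_deviation
    (L Cφ Cc : ℝ) (hL : 0 < L) (hCφ : 0 < Cφ) (hCc : 0 < Cc) :
    ∃ K : ℝ, 0 < K ∧
      ∀ (φ : ℝ → ℝ) (j : ℕ) (Kf : Finset (ℤ × ℤ)) (c : ℝ × ℝ → ℝ)
        (n₂ : ℕ) (ν : Measure (ℝ × ℝ)) (d cjk : ℤ × ℤ → ℝ) (T : ℝ)
        (Tdia : (Fin n₂ → ℝ × ℝ) → ℝ),
        1 ≤ n₂ →
        Measurable φ → (∀ t, |φ t| ≤ Cφ) → (∀ t ∉ Set.Icc (0 : ℝ) L, φ t = 0) →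
        (∀ k ∉ Kf, ∀ z ∈ unitSq, phiJK φ j k z = 0) →
        (∀ k ∈ Kf, ∀ k' ∈ Kf,
          (∫ z in unitSq, phiJK φ j k z * phiJK φ j k' z) = if k = k' then 1 else 0) →
        Measurable c → (∀ z, 0 ≤ c z) → (∀ z, c z ≤ Cc) → (∀ z ∉ unitSq, c z = 0) →
        ν = volume.withDensity (fun z => ENNReal.ofReal (c z)) →
        IsProbabilityMeasure ν →
        (∀ k, cjk k = ∫ z in unitSq, phiJK φ j k z * c z) →
        T = ∑ k ∈ Kf, (cjk k - d k) ^ 2 → 0 < T →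
        (∀ ω, Tdia ω = (n₂ : ℝ)⁻¹ * ∑ i : Fin n₂, ∑ k ∈ Kf,
          (phiJK φ j k (ω i) - cjk k) * (cjk k - d k)) →
        ∀ x : ℝ, 0 < x →
          (Measure.pi fun _ : Fin n₂ => ν) {ω | x ≤ |Tdia ω|} ≤
            ENNReal.ofReal
              (2 * Real.exp (-(K * (n₂ : ℝ) * x ^ 2 /
                (T + x * (2 : ℝ) ^ j * Real.sqrt T)))) := by
  set A := (L + 1) ^ 2 * Cφ ^ 2 with hA_def
  have hA : 0 < A := by positivity
  refine ⟨1 / (4 * (Cc + A)), by positivity, ?_⟩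
  intro φ j Kf c n ν d cjk T Tdia hn hm hφ hsupp _ horth hcm hc0 hcC hcs hν hprob hcjk hT hTpos
    hTdia x hx
  set a : ℤ × ℤ → ℝ := fun k => cjk k - d k
  set g : ℝ × ℝ → ℝ := fun z => ∑ k ∈ Kf, phiJK φ j k z * a k
  set m := ∑ k ∈ Kf, cjk k * a k
  set M := A * 2 ^ j * √T with hM_def
  have hM : 0 < M := by positivity
  have hgm : Measurable g :=
    Finset.measurable_fun_sum _ fun k _ => (measurable_phiJK hm j k).mul_const _
  have hgM (z : ℝ × ℝ) : |g z| ≤ M := by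
    refine (abs_sum_phiJK_mul_le hL.le hφ hsupp j Kf a z).trans_eq ?_
    rw [← hT, hM_def, hA_def]
    ring
  have hgsq (z : ℝ × ℝ) : ‖g z ^ 2‖ ≤ M ^ 2 := by
    rw [norm_pow]
    exact pow_le_pow_left₀ (norm_nonneg _) (hgM z) 2
  have hgi : Integrable g ν := .of_bound hgm.aestronglyMeasurable M (.of_forall hgM)
  have hgi2 : Integrable (fun z => g z ^ 2) ν :=
    .of_bound (by fun_prop) (M ^ 2) (.of_forall hgsq)
  have hmean : ∫ z, g z ∂ν = m := by
    rw [integral_finsetSum]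
    · refine Finset.sum_congr rfl fun k _ => ?_
      rw [integral_mul_const, hν, integral_withDensity_eq_setIntegral hcm hc0 hcs, hcjk]
    · exact fun k _ => (Integrable.of_bound (measurable_phiJK hm j k).aestronglyMeasurable _
        (.of_forall (abs_phiJK_le hφ j k))).mul_const _
  have hmM : |m| ≤ M := by
    rw [← hmean]
    simpa using norm_integral_le_of_norm_le_const (μ := ν) (f := g) (.of_forall hgM)
  have hsecond : ∫ z, g z ^ 2 ∂ν ≤ Cc * T := by
    have := isFiniteMeasure_restrict_unitSq
    rw [hν, integral_withDensity_eq_setIntegral hcm hc0 hcs, hT,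
      ← setIntegral_sq_sum_phiJK_mul hm hφ j Kf a horth, ← integral_const_mul]
    refine integral_mono_of_nonneg (.of_forall fun z => mul_nonneg (sq_nonneg _) (hc0 z))
      ((Integrable.of_bound (by fun_prop) (M ^ 2) (.of_forall hgsq)).const_mul Cc)
      (.of_forall fun z => ?_)
    dsimp only
    rw [mul_comm]
    exact mul_le_mul_of_nonneg_right (hcC z) (sq_nonneg _)
  have hcenter : ∫ z, (g z - m) ∂ν = 0 := by
    rw [integral_sub hgi (integrable_const m), hmean]
    simp
  have hvar : ∫ z, (g z - m) ^ 2 ∂ν ≤ Cc * T := by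
    have hexp : ∫ z, (g z - m) ^ 2 ∂ν = (∫ z, g z ^ 2 ∂ν) - m ^ 2 := by
      have (z : ℝ × ℝ) : (g z - m) ^ 2 = g z ^ 2 - (2 * m * g z - m ^ 2) := by ring
      simp_rw [this]
      have hlin : Integrable (fun z => 2 * m * g z - m ^ 2) ν :=
        (hgi.const_mul _).sub (integrable_const _)
      rw [integral_sub hgi2 hlin,
        integral_sub (hgi.const_mul _) (integrable_const _), integral_const_mul, hmean]
      simp
      ring
    linarith [sq_nonneg m]
  have hbern := measureReal_pi_le_abs_sum_le_exp (ν := ν) (hgm.sub_const m) (B := 2 * M)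
    (fun z => (abs_sub _ _).trans (by linarith [hgM z])) hcenter hvar (by positivity) n hx
    (by positivity)
  have hn0 : (0 : ℝ) < n := by exact_mod_cast hn
  have hset : {ω | x ≤ |Tdia ω|} = {ω : Fin n → ℝ × ℝ | n * x ≤ |∑ i, (g (ω i) - m)|} := by
    ext ω
    have hsum : Tdia ω = (n : ℝ)⁻¹ * ∑ i, (g (ω i) - m) := by
      rw [hTdia]
      congr 1
      refine Finset.sum_congr rfl fun i _ => ?_
      rw [← Finset.sum_sub_distrib]
      exact Finset.sum_congr rfl fun k _ => sub_mul _ _ _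
    rw [Set.mem_ofPred_eq, Set.mem_ofPred_eq, hsum, abs_mul, abs_of_pos (inv_pos.mpr hn0),
      le_inv_mul_iff₀ hn0]
  rw [hset, ← ofReal_measureReal]
  refine ENNReal.ofReal_le_ofReal (hbern.trans ?_)
  have hden : 4 * (Cc * T) + 2 * (2 * M) * x ≤ 4 * (Cc + A) * (T + x * 2 ^ j * √T) := by
    have h1 : 0 ≤ Cc * (x * 2 ^ j * √T) := by positivity
    have h2 : 0 ≤ A * T := by positivity
    rw [hM_def]
    linarith
  have hK : 1 / (4 * (Cc + A)) * n * x ^ 2 / (T + x * 2 ^ j * √T) =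
      n * x ^ 2 / (4 * (Cc + A) * (T + x * 2 ^ j * √T)) := by
    field_simp
  rw [hK]
  gcongr
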